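/- For every r₀ ∈ (0, 1/2) there exists a constant C > 0 depending only on n and r₀ with the following property (boundary Lipschitz estimate under an exterior sphere condition): let Ω ⊆ ℝⁿ be open with 0 ∈ ∂Ω and with the open ball B(−r₀·eₙ, r₀) of center −r₀·eₙ and radius r₀ disjoint from Ω; let u be continuous on (Ω ∩ B₁) ∪ (∂Ω ∩ B₁), harmonic on Ω ∩ B₁, with u = 0 on ∂Ω ∩ B₁ and |u| ≤ M on Ω ∩ B₁ for some M ≥ 0. Then |u(x)| ≤ C·M·|x| for every x ∈ Ω ∩ B_{r₀/2}. -/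

import Mathlib

noncomputable section

/-- The Laplacian of `u : ℝⁿ → ℝ`. -/
def lapl {m : ℕ} (u : EuclideanSpace ℝ (Fin m) → ℝ) (x : EuclideanSpace ℝ (Fin m)) : ℝ :=
  ∑ i : Fin m, fderiv ℝ (fun y => fderiv ℝ u y (EuclideanSpace.single i 1)) x
    (EuclideanSpace.single i 1)

/-- Harmonic on an open set: C² with vanishing Laplacian. -/
def IsHarmonicOn {m : ℕ} (u : EuclideanSpace ℝ (Fin m) → ℝ)
    (U : Set (EuclideanSpace ℝ (Fin m))) : Prop :=
  ContDiffOn ℝ 2 u U ∧ ∀ x ∈ U, lapl u x = 0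

/-- The unit vector `eₙ` in dimension `n + 2`. -/
def en (n : ℕ) : EuclideanSpace ℝ (Fin (n + 2)) := EuclideanSpace.single (Fin.last (n + 1)) 1

/-- The upper half ball `B_r⁺`. -/
def halfBall (n : ℕ) (r : ℝ) : Set (EuclideanSpace ℝ (Fin (n + 2))) :=
  {x | ‖x‖ < r ∧ 0 < x (Fin.last (n + 1))}

/-- The flat boundary part `T_r`. -/
def flatT (n : ℕ) (r : ℝ) : Set (EuclideanSpace ℝ (Fin (n + 2))) :=
  {x | ‖x‖ < r ∧ x (Fin.last (n + 1)) = 0}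

theorem fderiv_fderiv_nonpos_of_isLocalMax {E : Type*} [NormedAddCommGroup E] [NormedSpace ℝ E]
    {v : E → ℝ} {x : E} (hv : ContDiffAt ℝ 2 v x) (hmax : IsLocalMax v x) (e : E) :
    fderiv ℝ (fun y => fderiv ℝ v y e) x e ≤ 0 := by
  by_contra! hpos
  set ℓ : ℝ → E := fun t => x + t • e with hℓ
  have hℓ0 : ℓ 0 = x := by simp [hℓ]
  have hℓd : ∀ t, HasDerivAt ℓ e t := fun t => by
    simpa [hℓ] using ((hasDerivAt_id t).smul_const e).const_add x
  have hℓt : Filter.Tendsto ℓ (nhds 0) (nhds x) := by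
    simpa [hℓ0] using (hℓd 0).continuousAt.tendsto
  have hdiff : ∀ᶠ y in nhds x, DifferentiableAt ℝ v y :=
    (hv.eventually (by simp)).mono fun y hy => hy.differentiableAt (by norm_num)
  have hderiv : deriv (v ∘ ℓ) =ᶠ[nhds 0] fun t => fderiv ℝ v (ℓ t) e := by
    filter_upwards [hℓt.eventually hdiff] with t ht
    exact (ht.hasFDerivAt.comp_hasDerivAt t (hℓd t)).deriv
  have hd2 : DifferentiableAt ℝ (fun y => fderiv ℝ v y e) (ℓ 0) := by
    rw [hℓ0]
    exact ((hv.fderiv_right (m := 1) (by norm_num)).differentiableAt (by norm_num)).clm_apply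
      (differentiableAt_const e)
  have hsecond : deriv (deriv (v ∘ ℓ)) 0 = fderiv ℝ (fun y => fderiv ℝ v y e) x e := by
    rw [hderiv.deriv_eq, ← hℓ0]
    exact (hd2.hasFDerivAt.comp_hasDerivAt 0 (hℓd 0)).deriv
  have hmax' : IsLocalMax (v ∘ ℓ) 0 := by
    have := hℓt.eventually hmax
    simpa [IsLocalMax, IsMaxFilter, hℓ0] using this
  have hcont : ContinuousAt (v ∘ ℓ) 0 :=
    ContinuousAt.comp (by rw [hℓ0]; exact hv.continuousAt) (hℓd 0).continuousAt
  have hmin : IsLocalMin (v ∘ ℓ) 0 :=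
    isLocalMin_of_deriv_deriv_pos (hsecond ▸ hpos) hmax'.deriv_eq_zero hcont
  have hconst : v ∘ ℓ =ᶠ[nhds 0] fun _ => (v ∘ ℓ) 0 := by
    filter_upwards [hmax', hmin] with t h1 h2 using le_antisymm h1 h2
  have hzero : deriv (deriv (v ∘ ℓ)) 0 = 0 := by
    rw [hconst.deriv.deriv_eq]
    simp
  linarith

theorem lapl_nonpos_of_isLocalMax {m : ℕ} {v : EuclideanSpace ℝ (Fin m) → ℝ}
    {x : EuclideanSpace ℝ (Fin m)} (hv : ContDiffAt ℝ 2 v x) (hmax : IsLocalMax v x) :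
    lapl v x ≤ 0 :=
  Finset.sum_nonpos fun _ _ => fderiv_fderiv_nonpos_of_isLocalMax hv hmax _

theorem lapl_add_const_mul {m : ℕ} {u w : EuclideanSpace ℝ (Fin m) → ℝ}
    {x : EuclideanSpace ℝ (Fin m)} (hu : ContDiffAt ℝ 2 u x) (hw : ContDiffAt ℝ 2 w x) (a b : ℝ) :
    lapl (fun y => a * u y + b * w y) x = a * lapl u x + b * lapl w x := by
  have diff1 : ∀ {f : EuclideanSpace ℝ (Fin m) → ℝ}, ContDiffAt ℝ 2 f x →
      ∀ᶠ y in nhds x, DifferentiableAt ℝ f y := fun hf =>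
    (hf.eventually (by simp)).mono fun y hy => hy.differentiableAt (by norm_num)
  have diff2 : ∀ {f : EuclideanSpace ℝ (Fin m) → ℝ}, ContDiffAt ℝ 2 f x →
      ∀ e, DifferentiableAt ℝ (fun y => fderiv ℝ f y e) x := fun hf e =>
    ((hf.fderiv_right (m := 1) (by norm_num)).differentiableAt (by norm_num)).clm_apply
      (differentiableAt_const e)
  simp only [lapl, Finset.mul_sum, ← Finset.sum_add_distrib]
  refine Finset.sum_congr rfl fun i _ => ?_
  set e : EuclideanSpace ℝ (Fin m) := EuclideanSpace.single i 1
  have h : (fun y => fderiv ℝ (fun y => a * u y + b * w y) y e) =ᶠ[nhds x]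
      fun y => a * fderiv ℝ u y e + b * fderiv ℝ w y e := by
    filter_upwards [diff1 hu, diff1 hw] with y h1 h2
    rw [((h1.hasFDerivAt.const_mul a).fun_add (h2.hasFDerivAt.const_mul b)).fderiv]
    simp
  rw [h.fderiv_eq, (((diff2 hu e).hasFDerivAt.const_mul a).fun_add
    ((diff2 hw e).hasFDerivAt.const_mul b)).fderiv]
  simp

/-- The Gaussian centred at `c`, used to build barriers. -/
def gaussianAt {m : ℕ} (α : ℝ) (c x : EuclideanSpace ℝ (Fin m)) : ℝ :=
  Real.exp (-α * ‖x - c‖ ^ 2)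

theorem contDiff_gaussianAt {m : ℕ} (α : ℝ) (c : EuclideanSpace ℝ (Fin m)) :
    ContDiff ℝ 2 (gaussianAt α c) := by
  unfold gaussianAt
  exact (contDiff_const.mul ((contDiff_id.sub contDiff_const).norm_sq ℝ)).exp

theorem hasFDerivAt_gaussianAt {m : ℕ} (α : ℝ) (c x : EuclideanSpace ℝ (Fin m)) :
    HasFDerivAt (gaussianAt α c) ((-2 * α * gaussianAt α c x) • innerSL ℝ (x - c)) x := by
  unfold gaussianAt
  have h := ((((hasFDerivAt_id x).sub_const c).norm_sq).const_mul (-α)).exp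
  refine h.congr_fderiv ?_
  ext e
  simp
  ring

theorem lapl_gaussianAt {m : ℕ} (α : ℝ) (c x : EuclideanSpace ℝ (Fin m)) :
    lapl (gaussianAt α c) x =
      (4 * α ^ 2 * ‖x - c‖ ^ 2 - 2 * α * m) * gaussianAt α c x := by
  have hterm : ∀ i : Fin m,
      fderiv ℝ (fun y => fderiv ℝ (gaussianAt α c) y (EuclideanSpace.single i 1)) x
        (EuclideanSpace.single i 1) =
      (4 * α ^ 2 * (x - c) i ^ 2 - 2 * α) * gaussianAt α c x := by
    intro i
    have h1 : (fun y => fderiv ℝ (gaussianAt α c) y (EuclideanSpace.single i 1)) =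
        fun y => (-2 * α) * (gaussianAt α c y * inner ℝ (EuclideanSpace.single i 1) (y - c)) := by
      ext y
      rw [(hasFDerivAt_gaussianAt α c y).fderiv]
      simp only [smul_apply, innerSL_apply_apply, smul_eq_mul,
        real_inner_comm]
      ring
    have h2 : HasFDerivAt
        (fun y => inner ℝ (EuclideanSpace.single i (1 : ℝ)) (y - c))
        (innerSL ℝ (EuclideanSpace.single i (1 : ℝ))) x :=
      (innerSL ℝ (EuclideanSpace.single i (1 : ℝ))).hasFDerivAt.comp x
        ((hasFDerivAt_id x).sub_const c)
    have h3 : HasFDerivAt (fun y => fderiv ℝ (gaussianAt α c) y (EuclideanSpace.single i 1)) _ x :=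
      h1 ▸ ((hasFDerivAt_gaussianAt α c x).mul h2).const_mul (-2 * α)
    rw [h3.fderiv]
    simp [EuclideanSpace.inner_single_left, EuclideanSpace.inner_single_right]
    ring
  simp only [lapl, hterm, ← Finset.sum_mul, Finset.sum_sub_distrib, ← Finset.mul_sum,
    EuclideanSpace.real_norm_sq_eq]
  simp
  left
  ring

/-- One-sided comparison with a Gaussian barrier outside the ball `B(c, r)`. -/
theorem le_gaussian_barrier {m : ℕ} [NeZero m] {Ω : Set (EuclideanSpace ℝ (Fin m))}
    {u : EuclideanSpace ℝ (Fin m) → ℝ} {c : EuclideanSpace ℝ (Fin m)} {r R α A M : ℝ}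
    (hr : 0 < r) (hα : m / r ^ 2 = α) (hA : 0 < A)
    (hAM : A * (Real.exp (-α * r ^ 2) - Real.exp (-α * R ^ 2)) = M)
    (hΩ : IsOpen Ω) (hdisj : Disjoint (Metric.ball c r) Ω)
    (hcont : ContinuousOn u (closure Ω ∩ Metric.closedBall c R))
    (hharm : IsHarmonicOn u (Ω ∩ Metric.ball c R))
    (hzero : ∀ x ∈ frontier Ω ∩ Metric.closedBall c R, u x = 0)
    (hbdd : ∀ x ∈ Ω ∩ Metric.closedBall c R, u x ≤ M) :
    ∀ x ∈ Ω ∩ Metric.closedBall c R, u x ≤ A * (Real.exp (-α * r ^ 2) - gaussianAt α c x) := by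
  have hm : (0 : ℝ) < m := by exact_mod_cast Nat.pos_of_ne_zero (NeZero.ne m)
  have hαr : α * r ^ 2 = m := by rw [← hα]; field_simp
  have hα0 : 0 < α := by rw [← hα]; positivity
  have hdist : ∀ z ∈ closure Ω, r ≤ ‖z - c‖ := by
    intro z hz
    by_contra! h
    exact (hdisj.closure_right Metric.isOpen_ball).le_bot
      ⟨by rwa [Metric.mem_ball, dist_eq_norm], hz⟩
  intro x hx
  set v : EuclideanSpace ℝ (Fin m) → ℝ := fun y => 1 * u y + A * gaussianAt α c y with hv
  have hK : IsCompact (closure Ω ∩ Metric.closedBall c R) :=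
    (isCompact_closedBall c R).inter_left isClosed_closure
  obtain ⟨z, hz, hzmax⟩ := hK.exists_isMaxOn ⟨x, subset_closure hx.1, hx.2⟩
    ((continuousOn_const.mul hcont).add
      (continuousOn_const.mul (contDiff_gaussianAt α c).continuous.continuousOn) :
      ContinuousOn v _)
  have hxz : v x ≤ v z := hzmax ⟨subset_closure hx.1, hx.2⟩
  suffices hvz : v z ≤ A * Real.exp (-α * r ^ 2) by
    simp only [hv] at hxz hvz
    linarith
  by_cases hzΩ : z ∈ Ω
  · rcases (Metric.mem_closedBall.1 hz.2).lt_or_eq with hlt | heq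
    · exfalso
      have hopen : IsOpen (Ω ∩ Metric.ball c R) := hΩ.inter Metric.isOpen_ball
      have hmem : Ω ∩ Metric.ball c R ∈ nhds z := hopen.mem_nhds ⟨hzΩ, hlt⟩
      have hu2 : ContDiffAt ℝ 2 u z := hharm.1.contDiffAt hmem
      have hg2 : ContDiffAt ℝ 2 (gaussianAt α c) z := (contDiff_gaussianAt α c).contDiffAt
      have hloc : IsLocalMax v z := hzmax.isLocalMax
        (Filter.mem_of_superset hmem
          (Set.inter_subset_inter subset_closure Metric.ball_subset_closedBall))
      have hle := lapl_nonpos_of_isLocalMax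
        ((contDiffAt_const.mul hu2).add (contDiffAt_const.mul hg2)) hloc
      rw [lapl_add_const_mul hu2 hg2, hharm.2 z ⟨hzΩ, hlt⟩, lapl_gaussianAt] at hle
      have hsq : r ^ 2 ≤ ‖z - c‖ ^ 2 := by
        have := hdist z hz.1
        gcongr
      have hpos : 0 < 4 * α ^ 2 * ‖z - c‖ ^ 2 - 2 * α * m := by
        have : α ^ 2 * r ^ 2 ≤ α ^ 2 * ‖z - c‖ ^ 2 := by gcongr
        have h' : α ^ 2 * r ^ 2 = α * m := by rw [← hαr]; ring
        have := mul_pos hα0 hm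
        linarith
      have : 0 < A * ((4 * α ^ 2 * ‖z - c‖ ^ 2 - 2 * α * m) * gaussianAt α c z) :=
        mul_pos hA (mul_pos hpos (Real.exp_pos _))
      linarith
    · have := hbdd z ⟨hzΩ, hz.2⟩
      rw [dist_eq_norm] at heq
      simp only [hv, gaussianAt, heq]
      linarith
  · have hfr : z ∈ frontier Ω := by
      rw [hΩ.frontier_eq]
      exact ⟨hz.1, hzΩ⟩
    simp only [hv, hzero z ⟨hfr, hz.2⟩, gaussianAt, mul_zero, zero_add]
    have := hdist z hz.1
    gcongr ?_ * Real.exp ?_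
    simp only [neg_mul, neg_le_neg_iff]
    gcongr

theorem boundary_lipschitz_exterior_sphere (n : ℕ) (r₀ : ℝ) (hr₀ : 0 < r₀) (hr₀' : r₀ < 1 / 2) :
    ∃ C : ℝ, 0 < C ∧
      ∀ (Ω : Set (EuclideanSpace ℝ (Fin (n + 2)))) (u : EuclideanSpace ℝ (Fin (n + 2)) → ℝ)
        (M : ℝ), 0 ≤ M →
        IsOpen Ω → (0 : EuclideanSpace ℝ (Fin (n + 2))) ∈ frontier Ω →
        Disjoint (Metric.ball (-(r₀ • en n)) r₀) Ω →
        ContinuousOn u ((Ω ∩ Metric.ball 0 1) ∪ (frontier Ω ∩ Metric.ball 0 1)) →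
        IsHarmonicOn u (Ω ∩ Metric.ball 0 1) →
        (∀ x ∈ frontier Ω ∩ Metric.ball 0 1, u x = 0) →
        (∀ x ∈ Ω ∩ Metric.ball 0 1, |u x| ≤ M) →
        ∀ x ∈ Ω ∩ Metric.ball 0 (r₀ / 2), |u x| ≤ C * M * ‖x‖ := by
  set c : EuclideanSpace ℝ (Fin (n + 2)) := -(r₀ • en n) with hc
  have hcn : ‖c‖ = r₀ := by
    simp [hc, en, norm_smul, abs_of_pos hr₀]
  set δ : ℝ := (1 - 2 * r₀) / 2 with hδ
  have hδ0 : 0 < δ := by rw [hδ]; linarith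
  set R : ℝ := r₀ + δ with hR
  set α : ℝ := ((n + 2 : ℕ) : ℝ) / r₀ ^ 2 with hα
  have hα0 : 0 < α := by positivity
  set G : ℝ := Real.exp (-α * r₀ ^ 2) - Real.exp (-α * R ^ 2) with hG
  have hG0 : 0 < G := by
    have : r₀ ^ 2 < R ^ 2 := by gcongr; linarith
    rw [hG, sub_pos, Real.exp_lt_exp]
    nlinarith
  refine ⟨1 / δ + 2 * α / G, by positivity, ?_⟩
  intro Ω u M hM hΩ _ hdisj hcont hharm hzero hbdd x hx
  have hx1 : x ∈ Ω ∩ Metric.ball 0 1 :=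
    ⟨hx.1, Metric.ball_subset_ball (by linarith) hx.2⟩
  rcases hM.eq_or_lt with rfl | hM0
  · simpa using hbdd x hx1
  have hKball : Metric.closedBall c R ⊆ Metric.ball 0 1 := by
    intro y hy
    rw [mem_closedBall_iff_norm] at hy
    rw [mem_ball_zero_iff]
    have := norm_add_le (y - c) c
    rw [sub_add_cancel] at this
    linarith
  rcases le_or_gt δ ‖x‖ with hfar | hnear
  · have h1 : 1 ≤ ‖x‖ / δ := (one_le_div hδ0).2 hfar
    calc |u x| ≤ M * 1 := by simpa using hbdd x hx1
      _ ≤ M * (‖x‖ / δ) := by gcongr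
      _ = 1 / δ * M * ‖x‖ := by ring
      _ ≤ _ := by gcongr; simp; positivity
  have hxc : ‖x - c‖ ≤ ‖x‖ + r₀ := hcn ▸ norm_sub_le x c
  have hxK : x ∈ Ω ∩ Metric.closedBall c R :=
    ⟨hx.1, mem_closedBall_iff_norm.2 (by linarith)⟩
  have hcl : closure Ω ∩ Metric.closedBall c R ⊆
      (Ω ∩ Metric.ball 0 1) ∪ (frontier Ω ∩ Metric.ball 0 1) := by
    rw [← Set.union_inter_distrib_right, ← closure_eq_self_union_frontier]
    exact Set.inter_subset_inter_right _ hKball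
  have hsub : Ω ∩ Metric.ball c R ⊆ Ω ∩ Metric.ball 0 1 :=
    Set.inter_subset_inter_right _ (Metric.ball_subset_closedBall.trans hKball)
  have hAM : M / G * G = M := by field_simp
  have hupper := le_gaussian_barrier hr₀ hα.symm (div_pos hM0 hG0) hAM hΩ hdisj (hcont.mono hcl)
    ⟨hharm.1.mono hsub, fun y hy => hharm.2 y (hsub hy)⟩
    (fun y hy => hzero y ⟨hy.1, hKball hy.2⟩)
    (fun y hy => (abs_le.1 (hbdd y ⟨hy.1, hKball hy.2⟩)).2) x hxK
  have hlower := le_gaussian_barrier (u := fun y => -u y) hr₀ hα.symm (div_pos hM0 hG0) hAM hΩ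
    hdisj (hcont.mono hcl).neg
    ⟨(hharm.1.mono hsub).neg, fun y hy => by simpa [lapl] using hharm.2 y (hsub hy)⟩
    (fun y hy => by simpa using hzero y ⟨hy.1, hKball hy.2⟩)
    (fun y hy => neg_le.1 (abs_le.1 (hbdd y ⟨hy.1, hKball hy.2⟩)).1) x hxK
  have hbarrier : Real.exp (-α * r₀ ^ 2) - gaussianAt α c x ≤ 2 * α * ‖x‖ := by
    have hsq : ‖x - c‖ ^ 2 ≤ (‖x‖ + r₀) ^ 2 := by gcongr
    have hsq' : ‖x - c‖ ^ 2 - r₀ ^ 2 ≤ 2 * ‖x‖ := by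
      nlinarith [norm_nonneg x]
    have hexp := Real.add_one_le_exp (-α * (‖x - c‖ ^ 2 - r₀ ^ 2))
    have hfac : gaussianAt α c x =
        Real.exp (-α * r₀ ^ 2) * Real.exp (-α * (‖x - c‖ ^ 2 - r₀ ^ 2)) := by
      rw [gaussianAt, ← Real.exp_add]
      ring_nf
    have hle1 : Real.exp (-α * r₀ ^ 2) ≤ 1 := Real.exp_le_one_iff.2 (by nlinarith [sq_nonneg r₀])
    calc Real.exp (-α * r₀ ^ 2) - gaussianAt α c x
        = Real.exp (-α * r₀ ^ 2) * (1 - Real.exp (-α * (‖x - c‖ ^ 2 - r₀ ^ 2))) := by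
          rw [hfac]; ring
      _ ≤ Real.exp (-α * r₀ ^ 2) * (2 * α * ‖x‖) := by
          gcongr
          nlinarith
      _ ≤ 2 * α * ‖x‖ := mul_le_of_le_one_left (by positivity) hle1
  calc |u x| ≤ M / G * (Real.exp (-α * r₀ ^ 2) - gaussianAt α c x) :=
        abs_le.2 ⟨by linarith, hupper⟩
    _ ≤ M / G * (2 * α * ‖x‖) := by gcongr
    _ = 2 * α / G * M * ‖x‖ := by ring
    _ ≤ _ := by gcongr; simp; positivity
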